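/- arXiv:2510.26134 — 4 statements merged into one kernel-verified Lean document; each statement's English description precedes it below -/
import Mathlib

section
/- (Graham–Yao–Yao.) Let P be a finite poset whose ground set is the disjoint union of two chains X and Y. Let x ∈ X, y ∈ Y, let I ⊆ X × Y, and let R be the event {f ∈ E(P) : f(x') < f(y') for all (x',y') ∈ I}. Then ℙ({x ≺ y} ∩ R) ≥ ℙ(x ≺ y) · ℙ(R); equivalently, if R is nonempty then ℙ(x ≺ y | R) ≥ ℙ(x ≺ y). -/
open Finset

section Defs
variable (α : Type*) [Fintype α] [PartialOrder α]

/-- Linear extensions of a finite poset `α` with `n` elements: order-preserving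
bijections to `Fin n` (representing the target `{1,…,n}`). -/
def LinExt : Type _ :=
  {f : α ≃ Fin (Fintype.card α) // ∀ x y : α, x < y → f x < f y}

instance : Finite (LinExt α) := by unfold LinExt; infer_instance

noncomputable instance : Fintype (LinExt α) := Fintype.ofFinite _

end Defs

section Defs2
variable {α : Type*} [Fintype α] [PartialOrder α]

/-- the uniform probability `ℙ(E)` of an event `E` on linear extensions -/
noncomputable def Pr (E : LinExt α → Prop) : ℝ :=
  (Nat.card {f : LinExt α // E f} : ℝ) / (Nat.card (LinExt α) : ℝ)

/-- the value `f(x) ∈ {1,…,n}` of a linear extension at `x` -/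
def val (f : LinExt α) (x : α) : ℕ := (f.1 x : ℕ) + 1

/-- `ℙ(x ≺ y)`, the probability that `x` precedes `y` in a uniform linear extension -/
noncomputable def prLT (x y : α) : ℝ := Pr (fun f => val f x < val f y)

/-- the expectation `𝔼 f(x)` for `f` uniform on `E(P)` -/
noncomputable def expec (x : α) : ℝ :=
  (∑ f : LinExt α, (val f x : ℝ)) / (Nat.card (LinExt α) : ℝ)

/-- the variance `Var(f(x))` for `f` uniform on `E(P)` -/
noncomputable def variance (x : α) : ℝ :=
  (∑ f : LinExt α, ((val f x : ℝ) - expec x) ^ 2) / (Nat.card (LinExt α) : ℝ)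

/-- the standard deviation `σ(x)` of `f(x)` -/
noncomputable def sigma (x : α) : ℝ := Real.sqrt (variance x)

/-- `π(x)`: the number of elements of the poset incomparable to `x` -/
noncomputable def piVal (x : α) : ℕ := Nat.card {y : α // ¬ x ≤ y ∧ ¬ y ≤ x}

/-- `q(x) = max_{k ∈ {1,…,n}} ℙ(f(x) = k)` -/
noncomputable def qVal (x : α) : ℝ :=
  ⨆ k : Fin (Fintype.card α), Pr (fun f => val f x = (k : ℕ) + 1)

end Defs2

/-- an incomparable pair of subsets of a poset -/
def IncompPair {β : Type} [Fintype β] [PartialOrder β] (A B : Finset β) : Prop :=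
  Disjoint A B ∧ ∀ a ∈ A, ∀ b ∈ B, ¬ a ≤ b ∧ ¬ b ≤ a

/-- `TwoChains xc yc` says the finite poset `β` is the disjoint union of the chains
`X = {xc 0 < xc 1 < ⋯}` (of size `m`) and `Y = {yc 0 < yc 1 < ⋯}` (of size `n`). -/
structure TwoChains {β : Type} [Fintype β] [PartialOrder β] {m n : ℕ}
    (xc : Fin m → β) (yc : Fin n → β) : Prop where
  cover : ∀ b : β, (∃ i, b = xc i) ∨ (∃ j, b = yc j)
  disj : ∀ i j, xc i ≠ yc j
  xchain : ∀ i j, xc i ≤ xc j ↔ i ≤ j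
  ychain : ∀ i j, yc i ≤ yc j ↔ i ≤ j

/-- the poset is unidirectional: no relations `x_i > y_j` -/
def Unidir {β : Type} [Fintype β] [PartialOrder β] {m n : ℕ}
    (xc : Fin m → β) (yc : Fin n → β) : Prop :=
  ∀ (i : Fin m) (j : Fin n), ¬ yc j ≤ xc i

/-- the event `Ψ_{i,j} = {y_j ≺ x_i ≺ y_{j+1}}` (indices `1 ≤ i ≤ m`, `0 ≤ j ≤ n`,
with the conventions `Ψ_{i,0} = {x_i ≺ y_1}` and `Ψ_{i,n} = {y_n ≺ x_i}`);
here `xi : β` denotes the element `x_i`. -/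
def PsiEvent {β : Type} [Fintype β] [PartialOrder β] {n : ℕ}
    (yc : Fin n → β) (xi : β) (j : ℕ) (f : LinExt β) : Prop :=
  (∀ k : Fin n, (k : ℕ) + 1 = j → val f (yc k) < val f xi) ∧
  (∀ k : Fin n, (k : ℕ) = j → val f xi < val f (yc k))

/-- An injective strictly monotone `ℕ`-valued function on a finite poset is order-equivalent to a
linear extension. -/
lemma exists_linExt_of_injective {α : Type*} [Fintype α] [PartialOrder α] (k : α → ℕ)
    (hinj : Function.Injective k) (hk : StrictMono k) :
    ∃ f : LinExt α, ∀ u v, val f u < val f v ↔ k u < k v := by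
  have hcard : (univ.image k).card = Fintype.card α := by
    rw [card_image_of_injective _ hinj, card_univ]
  let e := (univ.image k).orderIsoOfFin hcard
  let g : α → Fin (Fintype.card α) := fun u => e.symm ⟨k u, mem_image_of_mem k (mem_univ u)⟩
  have hg : ∀ u v, g u < g v ↔ k u < k v := fun u v => by simp [g]
  have hginj : Function.Injective g := fun u v h => hinj (by simpa [g] using h)
  have hbij : Function.Bijective g :=
    (Fintype.bijective_iff_injective_and_card g).2 ⟨hginj, by simp⟩
  refine ⟨⟨Equiv.ofBijective g hbij, fun u v h => (hg u v).2 (hk h)⟩, fun u v => ?_⟩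
  rw [← hg]
  simp [_root_.val]

/-- A linear extension is determined by the comparisons it makes. -/
lemma linExt_ext {α : Type*} [Fintype α] [PartialOrder α] {f g : LinExt α}
    (h : ∀ u v, val f u < val f v ↔ val g u < val g v) : f = g := by
  have hlt : ∀ u v, f.1 u < f.1 v ↔ g.1 u < g.1 v := fun u v => by simpa [_root_.val] using h u v
  have hmono : StrictMono (f.1.symm.trans g.1) := fun a b hab => by
    simpa [← hlt] using hab
  let e : Fin (Fintype.card α) ≃o Fin (Fintype.card α) :=
    hmono.orderIsoOfSurjective _ (Equiv.surjective _)
  have he : e = OrderIso.refl _ := Subsingleton.elim _ _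
  refine Subtype.ext (Equiv.ext fun u => ?_)
  have := congrArg (fun e' : Fin (Fintype.card α) ≃o Fin (Fintype.card α) => e' (f.1 u)) he
  simpa [e] using this.symm

section IsAdmissible

variable {β : Type*} [PartialOrder β] {m n : ℕ} {xc : Fin m → β} {yc : Fin n → β}

/-- The sets `A` of pairs `(a, b)` that can be the set of pairs with `xc a` before `yc b` in a
linear extension. -/
structure IsAdmissible (xc : Fin m → β) (yc : Fin n → β) (A : Finset (Fin m × Fin n)) :
    Prop where
  mem_of_le : ∀ a a' b b', (a, b) ∈ A → a' ≤ a → b ≤ b' → (a', b') ∈ A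
  mem_of_lt : ∀ a b, xc a < yc b → (a, b) ∈ A
  notMem_of_lt : ∀ a b, yc b < xc a → (a, b) ∉ A

lemma IsAdmissible.inter {A B : Finset (Fin m × Fin n)} (hA : IsAdmissible xc yc A)
    (hB : IsAdmissible xc yc B) : IsAdmissible xc yc (A ∩ B) where
  mem_of_le a a' b b' hab ha hb := by
    rw [mem_inter] at hab ⊢
    exact ⟨hA.mem_of_le a a' b b' hab.1 ha hb, hB.mem_of_le a a' b b' hab.2 ha hb⟩
  mem_of_lt a b hab := mem_inter.2 ⟨hA.mem_of_lt a b hab, hB.mem_of_lt a b hab⟩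
  notMem_of_lt a b hab hmem := hA.notMem_of_lt a b hab (mem_inter.1 hmem).1

lemma IsAdmissible.union {A B : Finset (Fin m × Fin n)} (hA : IsAdmissible xc yc A)
    (hB : IsAdmissible xc yc B) : IsAdmissible xc yc (A ∪ B) where
  mem_of_le a a' b b' hab ha hb := by
    rw [mem_union] at hab ⊢
    exact hab.imp (hA.mem_of_le a a' b b' · ha hb) (hB.mem_of_le a a' b b' · ha hb)
  mem_of_lt a b hab := mem_union_left _ (hA.mem_of_lt a b hab)
  notMem_of_lt a b hab hmem := (mem_union.1 hmem).elim (hA.notMem_of_lt a b hab)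
    (hB.notMem_of_lt a b hab)

end IsAdmissible

section TwoChains

variable {β : Type} [Fintype β] [PartialOrder β] {m n : ℕ} {xc : Fin m → β} {yc : Fin n → β}

open Classical in
/-- The set of pairs `(a, b)` for which `f` puts `xc a` before `yc b`. -/
noncomputable def precedingPairs (xc : Fin m → β) (yc : Fin n → β) (f : LinExt β) :
    Finset (Fin m × Fin n) :=
  univ.filter fun p => val f (xc p.1) < val f (yc p.2)

lemma mem_precedingPairs {f : LinExt β} {p : Fin m × Fin n} :
    p ∈ precedingPairs xc yc f ↔ val f (xc p.1) < val f (yc p.2) := by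
  simp [precedingPairs]

lemma val_lt_val {f : LinExt β} {u v : β} (h : u < v) : val f u < val f v := by
  simpa [_root_.val] using f.2 u v h

lemma val_injective (f : LinExt β) : Function.Injective (val f) := fun u v h =>
  f.1.injective (Fin.ext (by simpa [_root_.val] using h))

lemma TwoChains.strictMono_left (h : TwoChains xc yc) : StrictMono xc :=
  strictMono_of_le_iff_le fun i j => (h.xchain i j).symm

lemma TwoChains.strictMono_right (h : TwoChains xc yc) : StrictMono yc :=
  strictMono_of_le_iff_le fun i j => (h.ychain i j).symm

lemma TwoChains.precedingPairs_injective (h : TwoChains xc yc) :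
    Function.Injective (precedingPairs xc yc) := by
  intro f g hfg
  have hxy : ∀ a b, val f (xc a) < val f (yc b) ↔ val g (xc a) < val g (yc b) := fun a b => by
    simpa [mem_precedingPairs] using congrArg (fun s => (a, b) ∈ s) hfg
  have hmono : ∀ k : LinExt β, StrictMono (val k ∘ xc) ∧ StrictMono (val k ∘ yc) := fun k =>
    ⟨fun _ _ hab => val_lt_val (h.strictMono_left hab),
      fun _ _ hab => val_lt_val (h.strictMono_right hab)⟩
  have hne : ∀ (k : LinExt β) a b, val k (xc a) ≠ val k (yc b) := fun k a b e =>
    h.disj a b (val_injective k e)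
  refine linExt_ext fun u v => ?_
  rcases h.cover u with ⟨a, rfl⟩ | ⟨b, rfl⟩ <;> rcases h.cover v with ⟨a', rfl⟩ | ⟨b', rfl⟩
  · exact (hmono f).1.lt_iff_lt.trans (hmono g).1.lt_iff_lt.symm
  · exact hxy a b'
  · have := hxy a' b
    have := hne f a' b
    have := hne g a' b
    omega
  · exact (hmono f).2.lt_iff_lt.trans (hmono g).2.lt_iff_lt.symm

lemma TwoChains.isAdmissible_precedingPairs (h : TwoChains xc yc) (f : LinExt β) :
    IsAdmissible xc yc (precedingPairs xc yc f) where
  mem_of_le a a' b b' hab ha hb := by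
    rw [mem_precedingPairs] at hab ⊢
    have hf : Monotone (val f) := StrictMono.monotone fun _ _ => val_lt_val
    exact (hf (h.strictMono_left.monotone ha)).trans_lt
      (hab.trans_le (hf (h.strictMono_right.monotone hb)))
  mem_of_lt a b hab := mem_precedingPairs.2 (val_lt_val hab)
  notMem_of_lt a b hab := by
    rw [mem_precedingPairs]
    exact (val_lt_val hab).not_gt

lemma TwoChains.exists_precedingPairs_eq (h : TwoChains xc yc) {A : Finset (Fin m × Fin n)}
    (hA : IsAdmissible xc yc A) : ∃ f : LinExt β, precedingPairs xc yc f = A := by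
  have hbij : Function.Bijective (Sum.elim xc yc) := by
    refine ⟨h.strictMono_left.injective.sumElim h.strictMono_right.injective h.disj, fun u => ?_⟩
    rcases h.cover u with ⟨a, rfl⟩ | ⟨b, rfl⟩
    exacts [⟨.inl a, rfl⟩, ⟨.inr b, rfl⟩]
  let e := Equiv.ofBijective _ hbij
  let kx : Fin m → ℕ := fun a => a + #{b | (a, b) ∉ A}
  let ky : Fin n → ℕ := fun b => b + #{a | (a, b) ∈ A}
  have hkx : StrictMono kx := fun a a' haa' => by
    refine add_lt_add_of_lt_of_le haa' (card_le_card fun b => ?_)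
    simpa using fun hb hb' => hb (hA.mem_of_le _ _ _ _ hb' haa'.le le_rfl)
  have hky : StrictMono ky := fun b b' hbb' => by
    refine add_lt_add_of_lt_of_le hbb' (card_le_card fun a => ?_)
    simpa using fun ha => hA.mem_of_le _ _ _ _ ha le_rfl hbb'.le
  have hmem : ∀ a b, (a, b) ∈ A → kx a < ky b := fun a b hab => by
    have h₁ : #{b' | (a, b') ∉ A} ≤ #(Iio b) := card_le_card fun b' => by
      simpa using fun hb' => lt_of_not_ge fun hle => hb' (hA.mem_of_le _ _ _ _ hab le_rfl hle)
    have h₂ : #(Iic a) ≤ #{a' | (a', b) ∈ A} := card_le_card fun a' => by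
      simpa using fun hle => hA.mem_of_le _ _ _ _ hab hle le_rfl
    rw [Fin.card_Iio] at h₁
    rw [Fin.card_Iic] at h₂
    simp only [kx, ky]
    omega
  have hnotMem : ∀ a b, (a, b) ∉ A → ky b < kx a := fun a b hab => by
    have h₁ : #{a' | (a', b) ∈ A} ≤ #(Iio a) := card_le_card fun a' => by
      simpa using fun ha' => lt_of_not_ge fun hle => hab (hA.mem_of_le _ _ _ _ ha' hle le_rfl)
    have h₂ : #(Iic b) ≤ #{b' | (a, b') ∉ A} := card_le_card fun b' => by
      simpa using fun hle hb' => hab (hA.mem_of_le _ _ _ _ hb' le_rfl hle)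
    rw [Fin.card_Iio] at h₁
    rw [Fin.card_Iic] at h₂
    simp only [kx, ky]
    omega
  have hne : ∀ a b, kx a ≠ ky b := fun a b => by
    by_cases hab : (a, b) ∈ A
    exacts [(hmem a b hab).ne, (hnotMem a b hab).ne']
  let k : β → ℕ := Sum.elim kx ky ∘ e.symm
  have hk_left : ∀ a, k (xc a) = kx a := fun a => by
    rw [show xc a = e (.inl a) from rfl]
    simp [k]
  have hk_right : ∀ b, k (yc b) = ky b := fun b => by
    rw [show yc b = e (.inr b) from rfl]
    simp [k]
  have hinj : Function.Injective k :=
    (hkx.injective.sumElim hky.injective hne).comp e.symm.injective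
  have hk : StrictMono k := fun u v huv => by
    rcases h.cover u with ⟨a, rfl⟩ | ⟨b, rfl⟩ <;> rcases h.cover v with ⟨a', rfl⟩ | ⟨b', rfl⟩ <;>
      simp only [hk_left, hk_right]
    · exact hkx (h.strictMono_left.lt_iff_lt.1 huv)
    · exact hmem _ _ (hA.mem_of_lt _ _ huv)
    · exact hnotMem _ _ (hA.notMem_of_lt _ _ huv)
    · exact hky (h.strictMono_right.lt_iff_lt.1 huv)
  obtain ⟨f, hf⟩ := exists_linExt_of_injective k hinj hk
  refine ⟨f, ext fun ⟨a, b⟩ => ?_⟩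
  rw [mem_precedingPairs, hf, hk_left, hk_right]
  exact ⟨fun hlt => by_contra fun hab => hlt.not_gt (hnotMem a b hab), hmem a b⟩

open Classical in
/-- A positive correlation inequality for counts of linear extensions: `G` has to hold at every
extension whose set of preceding pairs is the union of those of an extension satisfying `E` and one
satisfying `F`. -/
lemma TwoChains.card_mul_card_le (h : TwoChains xc yc) (E F G : LinExt β → Prop)
    (hG : ∀ f g k, E f → F g →
      precedingPairs xc yc k = precedingPairs xc yc f ∪ precedingPairs xc yc g → G k) :
    Nat.card {f // E f} * Nat.card {f // F f} ≤ Nat.card (LinExt β) * Nat.card {f // G f} := by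
  have hcard : ∀ Q : LinExt β → Prop,
      Nat.card {f // Q f} = #((univ.filter Q).image (precedingPairs xc yc)) := fun Q => by
    rw [card_image_of_injective _ h.precedingPairs_injective, Nat.card_eq_fintype_card,
      Fintype.card_subtype]
  have htotal : Nat.card (LinExt β) = #(univ.image (precedingPairs xc yc)) := by
    rw [card_image_of_injective _ h.precedingPairs_injective, Nat.card_eq_fintype_card, card_univ]
  rw [hcard, hcard, hcard, htotal]
  refine (Finset.le_card_infs_mul_card_sups _ _).trans
    (Nat.mul_le_mul (card_le_card ?_) (card_le_card ?_))
  · rw [Finset.infs_subset_iff]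
    simp only [mem_image, mem_filter, mem_univ, true_and]
    rintro _ ⟨f, -, rfl⟩ _ ⟨g, -, rfl⟩
    exact h.exists_precedingPairs_eq
      ((h.isAdmissible_precedingPairs f).inter (h.isAdmissible_precedingPairs g))
  · rw [Finset.sups_subset_iff]
    simp only [mem_image, mem_filter, mem_univ, true_and]
    rintro _ ⟨f, hf, rfl⟩ _ ⟨g, hg, rfl⟩
    obtain ⟨k, hk⟩ := h.exists_precedingPairs_eq
      ((h.isAdmissible_precedingPairs f).union (h.isAdmissible_precedingPairs g))
    exact ⟨k, hG f g k hf hg hk, hk⟩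

end TwoChains

/-- Graham–Yao–Yao: for a finite poset that is the disjoint union of two
chains, `x ∈ X`, `y ∈ Y`, `I ⊆ X × Y` and `R = {x' ≺ y' ∀ (x',y') ∈ I}`,
`ℙ({x ≺ y} ∩ R) ≥ ℙ(x ≺ y)·ℙ(R)`. -/
theorem stmt_16 (β : Type) [Fintype β] [PartialOrder β] (m n : ℕ)
    (xc : Fin m → β) (yc : Fin n → β) (htc : TwoChains xc yc)
    (i : Fin m) (j : Fin n) (I : Finset (Fin m × Fin n)) :
    prLT (xc i) (yc j) * Pr (fun f => ∀ p ∈ I, val f (xc p.1) < val f (yc p.2)) ≤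
      Pr (fun f => val f (xc i) < val f (yc j) ∧
        ∀ p ∈ I, val f (xc p.1) < val f (yc p.2)) := by
  have hcount := htc.card_mul_card_le (fun f => val f (xc i) < val f (yc j))
    (fun f => ∀ p ∈ I, val f (xc p.1) < val f (yc p.2))
    (fun f => val f (xc i) < val f (yc j) ∧ ∀ p ∈ I, val f (xc p.1) < val f (yc p.2))
    fun f g k hf hg hk => by
      have hmem : ∀ p : Fin m × Fin n,
          val f (xc p.1) < val f (yc p.2) ∨ val g (xc p.1) < val g (yc p.2) →
            val k (xc p.1) < val k (yc p.2) := fun p hp => by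
        rwa [← mem_precedingPairs, hk, mem_union, mem_precedingPairs, mem_precedingPairs]
      exact ⟨hmem (i, j) (.inl hf), fun p hp => hmem p (.inr (hg p hp))⟩
  unfold prLT Pr
  rcases (Nat.card (LinExt β)).eq_zero_or_pos with h₀ | hpos
  · rw [h₀]
    simp
  · have hpos' : (0 : ℝ) < Nat.card (LinExt β) := by exact_mod_cast hpos
    rw [div_mul_div_comm, div_le_div_iff₀ (by positivity) hpos', ← mul_assoc]
    refine mul_le_mul_of_nonneg_right ?_ hpos'.le
    rw [mul_comm (Nat.card {f : LinExt β // _ ∧ _} : ℝ)]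
    exact_mod_cast hcount
end

section
/- Let P be a finite unidirectional poset on the disjoint union of chains X = {x_1 < ⋯ < x_m} and Y = {y_1 < ⋯ < y_n} (no relations x_i > y_j). For every ε > 0, every i ∈ {1,…,m} and every j ∈ {1,…,n}: if i < ε·j then ℙ(Ψ_{i,j}) < ε. -/
open Finset

section LinExtLemmas

variable {α : Type*} [Fintype α] [PartialOrder α]

/-- A linear extension is determined by the order in which it lists the elements. -/
theorem LinExt.eq_of_lt_iff {f g : LinExt α}
    (h : ∀ u v, f.1 u < f.1 v ↔ g.1 u < g.1 v) : f = g := by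
  let e : Fin (Fintype.card α) ≃o Fin (Fintype.card α) :=
    { toEquiv := f.1.symm.trans g.1
      map_rel_iff' := by
        intro p q
        have := h (f.1.symm q) (f.1.symm p)
        simp only [Equiv.apply_symm_apply] at this
        simp only [Equiv.trans_apply, ← not_lt, this] }
  have he : e = OrderIso.refl _ := Subsingleton.elim _ _
  refine Subtype.ext (Equiv.ext fun u => ?_)
  have := congrArg (fun e' => e' (f.1 u)) he
  simpa [e] using this.symm

/-- An injective strictly monotone labelling by natural numbers induces a linear extension. -/
theorem exists_linExt_of_key (key : α → ℕ) (hinj : Function.Injective key)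
    (hmono : ∀ u v, u < v → key u < key v) :
    ∃ f : LinExt α, ∀ u v, f.1 u < f.1 v ↔ key u < key v := by
  classical
  let e : α ≃ Set.range key := Equiv.ofInjective key hinj
  let o : Fin (Fintype.card α) ≃o Set.range key :=
    Fintype.orderIsoFinOfCardEq _ (Fintype.card_congr e).symm
  have ho : ∀ u v, (e.trans o.symm.toEquiv) u < (e.trans o.symm.toEquiv) v ↔ key u < key v := by
    intro u v
    change o.symm (e u) < o.symm (e v) ↔ _
    rw [o.symm.lt_iff_lt]
    rfl
  exact ⟨⟨e.trans o.symm.toEquiv, fun u v huv => (ho u v).2 (hmono u v huv)⟩, ho⟩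

end LinExtLemmas

section TwoChainLemmas

variable {β : Type} [Fintype β] [PartialOrder β] {m n : ℕ} {xc : Fin m → β} {yc : Fin n → β}

/-- The number of elements of the chain `Y` preceding `x_l` in the linear extension `f`. -/
def numBelow (xc : Fin m → β) (yc : Fin n → β) (f : LinExt β) (l : Fin m) : ℕ :=
  #{k : Fin n | f.1 (yc k) < f.1 (xc l)}

theorem LinExt.lt_iff_of_chain {p : ℕ} {c : Fin p → β} (hc : ∀ i j, c i ≤ c j ↔ i ≤ j)
    (f : LinExt β) (i j : Fin p) : f.1 (c i) < f.1 (c j) ↔ i < j := by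
  have hlt : ∀ i j, i < j → f.1 (c i) < f.1 (c j) := fun i j h =>
    f.2 _ _ (lt_of_le_not_ge ((hc i j).2 h.le) fun h' => absurd ((hc j i).1 h') (not_le.2 h))
  refine ⟨fun h => ?_, hlt i j⟩
  by_contra hij
  rcases (not_lt.1 hij).lt_or_eq with h' | h'
  · exact absurd h (hlt j i h').asymm
  · exact absurd h (by simp [h'])

theorem lt_numBelow_iff (htc : TwoChains xc yc) (f : LinExt β) (l : Fin m) (k : Fin n) :
    (k : ℕ) < numBelow xc yc f l ↔ f.1 (yc k) < f.1 (xc l) := by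
  constructor
  · intro h
    by_contra hk
    have hsub : ({k' : Fin n | f.1 (yc k') < f.1 (xc l)} : Finset (Fin n)) ⊆ Finset.Iio k := by
      intro k' hk'
      rw [Finset.mem_filter] at hk'
      rw [Finset.mem_Iio, ← f.lt_iff_of_chain htc.ychain]
      exact hk'.2.trans_le (not_lt.1 hk)
    have := Finset.card_le_card hsub
    rw [Fin.card_Iio] at this
    exact absurd h (not_lt.2 this)
  · intro h
    have hsub : Finset.Iic k ⊆ ({k' : Fin n | f.1 (yc k') < f.1 (xc l)} : Finset (Fin n)) := by
      intro k' hk'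
      rw [Finset.mem_Iic] at hk'
      refine Finset.mem_filter.2 ⟨Finset.mem_univ _, lt_of_le_of_lt ?_ h⟩
      rw [← not_lt, f.lt_iff_of_chain htc.ychain]
      exact not_lt.2 hk'
    have := Finset.card_le_card hsub
    rw [Fin.card_Iic] at this
    exact this

theorem numBelow_le (f : LinExt β) (l : Fin m) : numBelow xc yc f l ≤ n :=
  (Finset.card_le_univ _).trans_eq (Fintype.card_fin n)

theorem numBelow_monotone (htc : TwoChains xc yc) (f : LinExt β) :
    Monotone (numBelow xc yc f) := by
  intro l l' hl
  refine Finset.card_le_card (Finset.monotone_filter_right _ fun k _ hk => hk.trans_le ?_)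
  rw [← not_lt, f.lt_iff_of_chain htc.xchain]
  exact not_lt.2 hl

theorem numBelow_injective (htc : TwoChains xc yc) :
    Function.Injective (numBelow xc yc : LinExt β → Fin m → ℕ) := by
  intro f g h
  have hyx : ∀ k l, f.1 (yc k) < f.1 (xc l) ↔ g.1 (yc k) < g.1 (xc l) := fun k l => by
    rw [← lt_numBelow_iff htc, ← lt_numBelow_iff htc, h]
  have hxy : ∀ f : LinExt β, ∀ k l, f.1 (xc l) < f.1 (yc k) ↔ ¬ f.1 (yc k) < f.1 (xc l) :=
    fun f k l => by
      rw [not_lt, le_iff_lt_or_eq, or_iff_left]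
      exact fun h' => htc.disj l k (f.1.injective h')
  refine LinExt.eq_of_lt_iff fun u v => ?_
  rcases htc.cover u with ⟨i, rfl⟩ | ⟨i, rfl⟩ <;> rcases htc.cover v with ⟨j, rfl⟩ | ⟨j, rfl⟩
  · rw [f.lt_iff_of_chain htc.xchain, g.lt_iff_of_chain htc.xchain]
  · rw [hxy, hxy, hyx]
  · exact hyx i j
  · rw [f.lt_iff_of_chain htc.ychain, g.lt_iff_of_chain htc.ychain]

/-- For a unidirectional poset, the sequences counting the elements of `Y` below the elements
of `X` are closed under passing to a smaller monotone sequence. -/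
theorem exists_numBelow_eq (htc : TwoChains xc yc) (huni : Unidir xc yc) (f : LinExt β)
    {b : Fin m → ℕ} (hb : Monotone b) (hle : ∀ l, b l ≤ numBelow xc yc f l) :
    ∃ g : LinExt β, numBelow xc yc g = b := by
  have hxinj : Function.Injective xc := fun i j h =>
    le_antisymm ((htc.xchain i j).1 h.le) ((htc.xchain j i).1 h.ge)
  have hyinj : Function.Injective yc := fun i j h =>
    le_antisymm ((htc.ychain i j).1 h.le) ((htc.ychain j i).1 h.ge)
  let e : Fin m ⊕ Fin n ≃ β := Equiv.ofBijective (Sum.elim xc yc)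
    ⟨hxinj.sumElim hyinj htc.disj, fun u => by
      rcases htc.cover u with ⟨i, rfl⟩ | ⟨i, rfl⟩
      · exact ⟨Sum.inl i, rfl⟩
      · exact ⟨Sum.inr i, rfl⟩⟩
  let key : β → ℕ := fun u =>
    Sum.elim (fun l : Fin m => b l * (m + 1) + l) (fun k : Fin n => k * (m + 1) + m) (e.symm u)
  have hkx : ∀ l, key (xc l) = b l * (m + 1) + l := fun l => by
    have : e.symm (xc l) = Sum.inl l := e.symm_apply_eq.2 rfl
    simp [key, this]
  have hky : ∀ k, key (yc k) = k * (m + 1) + m := fun k => by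
    have : e.symm (yc k) = Sum.inr k := e.symm_apply_eq.2 rfl
    simp [key, this]
  have hxx : ∀ i j, i < j → key (xc i) < key (xc j) := fun i j hij => by
    rw [hkx, hkx]
    exact add_lt_add_of_le_of_lt (Nat.mul_le_mul_right _ (hb hij.le)) hij
  have hyy : ∀ i j, i < j → key (yc i) < key (yc j) := fun i j hij => by
    rw [hky, hky]
    gcongr
    exact hij
  have hxy : ∀ (l : Fin m) (k : Fin n), b l ≤ k → key (xc l) < key (yc k) := fun l k h => by
    rw [hkx, hky]
    exact add_lt_add_of_le_of_lt (Nat.mul_le_mul_right _ h) l.2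
  have hyx : ∀ (l : Fin m) (k : Fin n), k < b l → key (yc k) < key (xc l) := fun l k h => by
    rw [hkx, hky]
    have := Nat.mul_le_mul_right (m + 1) (Nat.succ_le_of_lt h)
    rw [Nat.succ_mul] at this
    omega
  have hkinj : Function.Injective key := by
    intro u v huv
    rcases htc.cover u with ⟨i, rfl⟩ | ⟨i, rfl⟩ <;> rcases htc.cover v with ⟨j, rfl⟩ | ⟨j, rfl⟩
    · rcases lt_trichotomy i j with h | h | h
      · exact absurd huv (hxx _ _ h).ne
      · rw [h]
      · exact absurd huv (hxx _ _ h).ne'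
    · rcases le_or_gt (b i) j with h | h
      · exact absurd huv (hxy _ _ h).ne
      · exact absurd huv (hyx _ _ h).ne'
    · rcases le_or_gt (b j) i with h | h
      · exact absurd huv (hxy _ _ h).ne'
      · exact absurd huv (hyx _ _ h).ne
    · rcases lt_trichotomy i j with h | h | h
      · exact absurd huv (hyy _ _ h).ne
      · rw [h]
      · exact absurd huv (hyy _ _ h).ne'
  have hkmono : ∀ u v, u < v → key u < key v := by
    intro u v huv
    rcases htc.cover u with ⟨i, rfl⟩ | ⟨i, rfl⟩ <;> rcases htc.cover v with ⟨j, rfl⟩ | ⟨j, rfl⟩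
    · exact hxx _ _ ((f.lt_iff_of_chain htc.xchain i j).1 (f.2 _ _ huv))
    · refine hxy _ _ ((hle i).trans ?_)
      rw [← not_lt, lt_numBelow_iff htc]
      exact (f.2 _ _ huv).asymm
    · exact absurd huv.le (huni j i)
    · exact hyy _ _ ((f.lt_iff_of_chain htc.ychain i j).1 (f.2 _ _ huv))
  obtain ⟨g, hg⟩ := exists_linExt_of_key key hkinj hkmono
  refine ⟨g, funext fun l => ?_⟩
  have hiff : ∀ k : Fin n, (k : ℕ) < numBelow xc yc g l ↔ (k : ℕ) < b l := fun k => by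
    rw [lt_numBelow_iff htc, hg]
    refine ⟨fun h => ?_, hyx l k⟩
    by_contra hk
    exact absurd h (hxy l k (not_lt.1 hk)).asymm
  have hgn := numBelow_le (xc := xc) (yc := yc) g l
  have hbn := (hle l).trans (numBelow_le f l)
  rcases lt_trichotomy (numBelow xc yc g l) (b l) with h | h | h
  · exact absurd ((hiff ⟨_, h.trans_le hbn⟩).2 h) (lt_irrefl _)
  · exact h
  · exact absurd ((hiff ⟨_, h.trans_le hgn⟩).1 h) (lt_irrefl _)

theorem numBelow_eq_of_psiEvent (htc : TwoChains xc yc) {f : LinExt β} {l : Fin m} {j : ℕ}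
    (hj1 : 1 ≤ j) (hjn : j ≤ n) (h : PsiEvent yc (xc l) j f) : numBelow xc yc f l = j := by
  have hlt : ∀ u v, _root_.val f u < _root_.val f v ↔ f.1 u < f.1 v := fun _ _ =>
    Nat.add_lt_add_iff_right
  refine le_antisymm (not_lt.1 fun hlt' => ?_) ?_
  · have hj : j < n := hlt'.trans_le (numBelow_le f l)
    have h1 := (hlt _ _).1 (h.2 ⟨j, hj⟩ rfl)
    exact h1.asymm ((lt_numBelow_iff htc f l ⟨j, hj⟩).1 hlt')
  · have h1 := (hlt _ _).1 (h.1 ⟨j - 1, by omega⟩ (Nat.sub_add_cancel hj1))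
    have h2 := (lt_numBelow_iff htc f l ⟨j - 1, by omega⟩).2 h1
    simp only at h2
    omega

end TwoChainLemmas

section InsertShift

variable {m : ℕ}

/-- Insert the value `s` at position `k` of a sequence and move the entries at positions
`k, …, i - 1` one step to the right while decreasing them by one; the entry at position `i`
is discarded. -/
def insertShift (i k : Fin m) (s : ℕ) (a : Fin m → ℕ) (l : Fin m) : ℕ :=
  if l < k then a l
  else if l = k then s
  else if l ≤ i then a ⟨l - 1, by omega⟩ - 1
  else a l

theorem insertShift_le {i k : Fin m} {s : ℕ} {a : Fin m → ℕ} (ha : Monotone a)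
    (hs : s < a k) (l : Fin m) : insertShift i k s a l ≤ a l := by
  have h : a ⟨l - 1, by omega⟩ ≤ a l := ha (Fin.le_def.2 (Nat.sub_le _ _))
  unfold insertShift
  split_ifs with h1 h2 h3
  · exact le_rfl
  · exact h2 ▸ hs.le
  · omega
  · exact le_rfl

theorem insertShift_monotone {i k : Fin m} {s : ℕ} {a : Fin m → ℕ} (ha : Monotone a)
    (hs : s < a k) (hk : ∀ l < k, a l ≤ s) : Monotone (insertShift i k s a) := by
  intro l l' hl
  rcases lt_or_ge l k with h1 | h1
  · rcases lt_or_ge l' k with h2 | h2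
    · simpa [insertShift, h1, h2] using ha hl
    · have hl1 : insertShift i k s a l = a l := by simp [insertShift, h1]
      rw [hl1]
      unfold insertShift
      split_ifs with h3 h4 h5
      · exact ha hl
      · exact hk l h1
      · have h6 : a k ≤ a ⟨l' - 1, by omega⟩ := ha (Fin.le_def.2 (by
          simp only [Fin.lt_def, Fin.ext_iff, Fin.le_def] at *; omega))
        have := hk l h1
        omega
      · exact ha hl
  · rcases eq_or_lt_of_le hl with rfl | hl'
    · exact le_rfl
    have h2 : k < l' := h1.trans_lt hl'
    by_cases h3 : l' ≤ i
    · have hl1 : insertShift i k s a l' = a ⟨l' - 1, by omega⟩ - 1 := by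
        simp [insertShift, h2.not_gt, h2.ne', h3]
      rw [hl1]
      unfold insertShift
      split_ifs with h4 h5 h6
      · exact absurd h4 (not_lt.2 h1)
      · have h6 : a k ≤ a ⟨l' - 1, by omega⟩ := ha (Fin.le_def.2 (by
          simp only [Fin.lt_def] at *; omega))
        omega
      · exact Nat.sub_le_sub_right (ha (Fin.le_def.2 (Nat.sub_le_sub_right hl 1))) 1
      · exact absurd (hl.trans h3) h6
    · have hl1 : insertShift i k s a l' = a l' := by
        simp [insertShift, h2.not_gt, h2.ne', h3]
      exact hl1 ▸ (insertShift_le ha hs l).trans (ha hl)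

theorem insertShift_inj {i k : Fin m} {s s' : ℕ} {a a' : Fin m → ℕ}
    (hki : k ≤ i) (ha : Monotone a) (ha' : Monotone a') (hs : s < a k) (hs' : s' < a' k)
    (hi : a i = a' i) (h : insertShift i k s a = insertShift i k s' a') : a = a' ∧ s = s' := by
  refine ⟨funext fun l => ?_, by simpa [insertShift] using congrFun h k⟩
  rcases lt_or_ge l k with h1 | h1
  · simpa [insertShift, h1] using congrFun h l
  rcases lt_trichotomy l i with h2 | h2 | h2
  · have h3 := congrFun h ⟨l + 1, by omega⟩
    have h4 : k < (⟨l + 1, by omega⟩ : Fin m) := Fin.lt_def.2 (Nat.lt_succ_of_le h1)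
    have h5 : (⟨l + 1, by omega⟩ : Fin m) ≤ i := Fin.le_def.2 h2
    simp only [insertShift, h4.not_gt, h4.ne', h5, if_true, if_false, Nat.add_sub_cancel,
      Fin.eta] at h3
    have := ha h1
    have := ha' h1
    omega
  · rw [h2, hi]
  · simpa [insertShift, h1.not_gt, h2.not_ge, (hki.trans_lt h2).ne'] using congrFun h l

end InsertShift

/-- The linear extensions in `Ψ_{i,j}`, paired with `j` labels, inject into all linear
extensions paired with `i` labels. -/
theorem mul_card_psiEvent_le {β : Type} [Fintype β] [PartialOrder β] {m n : ℕ}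
    {xc : Fin m → β} {yc : Fin n → β} (htc : TwoChains xc yc) (huni : Unidir xc yc)
    (i : Fin m) {j : ℕ} (hj1 : 1 ≤ j) (hjn : j ≤ n) :
    Nat.card {f : LinExt β // PsiEvent yc (xc i) j f} * j ≤
      Nat.card (LinExt β) * (i + 1) := by
  have key : ∀ p : {f : LinExt β // PsiEvent yc (xc i) j f} × Fin j,
      ∃ q : LinExt β × Fin (i + 1), ∃ k : Fin m, k ≤ i ∧ (k : ℕ) = q.2 ∧
        (p.2 : ℕ) < numBelow xc yc p.1.1 k ∧
        numBelow xc yc q.1 = insertShift i k p.2 (numBelow xc yc p.1.1) := by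
    rintro ⟨⟨f, hf⟩, s⟩
    have hfi : (s : ℕ) < numBelow xc yc f i :=
      (numBelow_eq_of_psiEvent htc hj1 hjn hf).symm ▸ s.2
    obtain ⟨k, hk, hmin⟩ :=
      WellFounded.has_min (wellFounded_lt (α := Fin m)) {l | (s : ℕ) < numBelow xc yc f l}
        ⟨i, hfi⟩
    have hki : k ≤ i := not_lt.1 (hmin i hfi)
    obtain ⟨g, hg⟩ := exists_numBelow_eq htc huni f
      (insertShift_monotone (i := i) (numBelow_monotone htc f) hk
        fun l hl => not_lt.1 fun h => hmin l h hl)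
      (insertShift_le (numBelow_monotone htc f) hk)
    exact ⟨(g, ⟨k, Nat.lt_succ_of_le hki⟩), k, hki, rfl, hk, hg⟩
  choose F K hKi hKF hK hF using key
  have hinj : Function.Injective F := by
    intro p p' h
    have hkk : K p = K p' := Fin.ext (by rw [hKF, hKF, h])
    have hp := numBelow_eq_of_psiEvent htc hj1 hjn p.1.2
    have hp' := numBelow_eq_of_psiEvent htc hj1 hjn p'.1.2
    have hFF := hF p
    rw [h, hF p', ← hkk] at hFF
    obtain ⟨h1, h2⟩ := insertShift_inj (hKi p) (numBelow_monotone htc _)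
      (numBelow_monotone htc _) (hK p) (hkk ▸ hK p') (hp.trans hp'.symm) hFF.symm
    exact Prod.ext (Subtype.ext (numBelow_injective htc h1)) (Fin.ext h2)
  have := Nat.card_le_card_of_injective F hinj
  simpa [Nat.card_prod] using this

/-- for a finite unidirectional poset on two chains, if `i < ε·j`
(`1 ≤ i ≤ m`, `1 ≤ j ≤ n`) then `ℙ(Ψ_{i,j}) < ε`. -/
theorem stmt_17 (β : Type) [Fintype β] [PartialOrder β] (m n : ℕ)
    (xc : Fin m → β) (yc : Fin n → β) (htc : TwoChains xc yc) (huni : Unidir xc yc)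
    (ε : ℝ) (hε : 0 < ε) (i j : ℕ) (hi1 : 1 ≤ i) (him : i ≤ m) (hj1 : 1 ≤ j) (hjn : j ≤ n)
    (hij : (i : ℝ) < ε * (j : ℝ)) :
    Pr (PsiEvent yc (xc ⟨i - 1, by omega⟩) j) < ε := by
  have hcard := mul_card_psiEvent_le htc huni ⟨i - 1, by omega⟩ hj1 hjn
  simp only [Nat.sub_add_cancel hi1] at hcard
  have hj : (0 : ℝ) < j := by exact_mod_cast hj1
  unfold Pr
  rcases (Nat.card (LinExt β)).eq_zero_or_pos with h0 | h0
  · rwa [h0, Nat.cast_zero, div_zero]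
  · have hN : (0 : ℝ) < Nat.card (LinExt β) := by exact_mod_cast h0
    rw [div_lt_iff₀ hN, ← mul_lt_mul_iff_left₀ hj]
    calc _ ≤ (Nat.card (LinExt β) : ℝ) * i := by exact_mod_cast hcard
      _ < Nat.card (LinExt β) * (ε * j) := by gcongr
      _ = _ := by ring
end

section
/- Let P = X + Y be the finite poset that is the disjoint union of chains X = {x_1 < ⋯ < x_m} and Y = {y_1 < ⋯ < y_n} with no order relations at all between X and Y. For every ε > 0: if m < ε·n − 1, then ℙ(Ψ_{i,j}) < ε for every i ∈ {1,…,m} and every j ∈ {0,1,…,n}. -/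
open Finset

namespace TwoChains

variable {β : Type} [Fintype β] [PartialOrder β] {m n : ℕ} {xc : Fin m → β} {yc : Fin n → β}

lemma xc_strictMono (htc : TwoChains xc yc) : StrictMono xc := fun i j hij =>
  lt_of_le_not_ge ((htc.xchain i j).2 hij.le) fun h => hij.not_ge ((htc.xchain j i).1 h)

lemma yc_strictMono (htc : TwoChains xc yc) : StrictMono yc := fun i j hij =>
  lt_of_le_not_ge ((htc.ychain i j).2 hij.le) fun h => hij.not_ge ((htc.ychain j i).1 h)

lemma comp_xc_strictMono (htc : TwoChains xc yc) (f : LinExt β) : StrictMono (f.1 ∘ xc) :=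
  fun _ _ hij => f.2 _ _ (htc.xc_strictMono hij)

lemma comp_yc_strictMono (htc : TwoChains xc yc) (f : LinExt β) : StrictMono (f.1 ∘ yc) :=
  fun _ _ hij => f.2 _ _ (htc.yc_strictMono hij)

lemma bijective_sumElim (htc : TwoChains xc yc) : Function.Bijective (Sum.elim yc xc) := by
  refine ⟨htc.yc_strictMono.injective.sumElim htc.xc_strictMono.injective
    fun j i h => htc.disj i j h.symm, fun b => ?_⟩
  rcases htc.cover b with ⟨i, rfl⟩ | ⟨j, rfl⟩
  exacts [⟨.inr i, rfl⟩, ⟨.inl j, rfl⟩]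

lemma card_eq (htc : TwoChains xc yc) : Fintype.card β = n + m := by
  simpa using (Fintype.card_of_bijective htc.bijective_sumElim).symm

lemma range_comp_xc (htc : TwoChains xc yc) (f : LinExt β) :
    Set.range (f.1 ∘ xc) = (Set.range (f.1 ∘ yc))ᶜ := by
  have hcompl : Set.range xc = (Set.range yc)ᶜ := by
    ext b
    constructor
    · rintro ⟨i, rfl⟩ ⟨j, h⟩
      exact htc.disj i j h.symm
    · intro hb
      rcases htc.cover b with ⟨i, rfl⟩ | ⟨j, rfl⟩
      exacts [⟨i, rfl⟩, (hb ⟨j, rfl⟩).elim]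
  rw [Set.range_comp, Set.range_comp, hcompl, Set.image_compl_eq f.1.bijective]

/-- A linear extension of a union of two chains is determined by its values on one of them. -/
lemma linExt_ext (htc : TwoChains xc yc) {f g : LinExt β} (h : f.1 ∘ yc = g.1 ∘ yc) : f = g := by
  have hx : f.1 ∘ xc = g.1 ∘ xc :=
    ((htc.comp_xc_strictMono f).range_inj (htc.comp_xc_strictMono g)).1 <| by
      rw [htc.range_comp_xc, htc.range_comp_xc, h]
  refine Subtype.ext (Equiv.ext fun b => ?_)
  rcases htc.cover b with ⟨i, rfl⟩ | ⟨j, rfl⟩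
  exacts [congrFun hx i, congrFun h j]

lemma choose_le_card_linExt (htc : TwoChains xc yc)
    (hnone : ∀ (i : Fin m) (j : Fin n), ¬ xc i ≤ yc j ∧ ¬ yc j ≤ xc i) :
    (n + m).choose n ≤ Nat.card (LinExt β) := by
  let e : Fin n ⊕ Fin m ≃ β := Equiv.ofBijective _ htc.bijective_sumElim
  have hinl (j) : e.symm (yc j) = .inl j := e.symm_apply_eq.2 rfl
  have hinr (i) : e.symm (xc i) = .inr i := e.symm_apply_eq.2 rfl
  have hcard (s : powersetCard n (univ : Finset (Fin (Fintype.card β)))) : #s.1 = n :=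
    (mem_powersetCard.1 s.2).2
  have hcompl (s : powersetCard n (univ : Finset (Fin (Fintype.card β)))) : #(s.1)ᶜ = m := by
    rw [card_compl, hcard, Fintype.card_fin, htc.card_eq, Nat.add_sub_cancel_left]
  let F (s : powersetCard n (univ : Finset (Fin (Fintype.card β)))) : LinExt β :=
    ⟨e.symm.trans (finSumEquivOfFinset (hcard s) (hcompl s)), by
      intro a b hab
      rcases htc.cover a with ⟨i, rfl⟩ | ⟨i, rfl⟩ <;> rcases htc.cover b with ⟨j, rfl⟩ | ⟨j, rfl⟩
      · simpa [hinr] using htc.xc_strictMono.lt_iff_lt.1 hab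
      · exact ((hnone i j).1 hab.le).elim
      · exact ((hnone j i).2 hab.le).elim
      · simpa [hinl] using htc.yc_strictMono.lt_iff_lt.1 hab⟩
  have hF (s) : Set.range ((F s).1 ∘ yc) = (s.1 : Set (Fin (Fintype.card β))) := by
    have : (F s).1 ∘ yc = s.1.orderEmbOfFin (hcard s) := by
      ext j
      simp [F, hinl]
    rw [this, range_orderEmbOfFin]
  have hinj : Function.Injective F := fun s t hst =>
    Subtype.ext (coe_injective (by rw [← hF s, ← hF t, hst]))
  have := Nat.card_le_card_of_injective F hinj
  simpa [htc.card_eq] using this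

lemma strictMono_comp_insertNth (htc : TwoChains xc yc) {a : β} {j : ℕ} (hj : j < n + 1)
    {f : LinExt β} (hf : PsiEvent yc a j f) :
    StrictMono (f.1 ∘ (Fin.insertNth ⟨j, hj⟩ a yc : Fin (n + 1) → β)) := by
  have hlow (k : Fin n) (hk : (k : ℕ) < j) : f.1 (yc k) < f.1 a := by
    have h := hf.1 ⟨j - 1, by omega⟩ (Nat.sub_add_cancel (by omega))
    exact ((htc.comp_yc_strictMono f).monotone (Fin.le_def.2 (by simp; omega))).trans_lt
      (Fin.lt_def.2 (Nat.lt_of_add_lt_add_right h))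
  have hhigh (k : Fin n) (hk : j ≤ (k : ℕ)) : f.1 a < f.1 (yc k) := by
    have h := hf.2 ⟨j, by omega⟩ rfl
    exact (Fin.lt_def.2 (Nat.lt_of_add_lt_add_right h)).trans_le
      ((htc.comp_yc_strictMono f).monotone (Fin.le_def.2 hk))
  intro p q hpq
  cases p using Fin.succAboveCases ⟨j, hj⟩ <;> cases q using Fin.succAboveCases ⟨j, hj⟩
  · exact (lt_irrefl _ hpq).elim
  · simpa using hhigh _ (Fin.lt_succAbove_iff_le_castSucc _ _ |>.1 hpq)
  · simpa using hlow _ (Fin.succAbove_lt_iff_castSucc_lt _ _ |>.1 hpq)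
  · simpa using htc.comp_yc_strictMono f (Fin.succAbove_lt_succAbove_iff.1 hpq)

/-- The values taken on `Y ∪ {a}` determine a linear extension in `PsiEvent yc a j`. -/
lemma card_psiEvent_le (htc : TwoChains xc yc) (a : β) {j : ℕ} (hj : j ≤ n) :
    Nat.card {f : LinExt β // PsiEvent yc a j f} ≤ (n + m).choose (n + 1) := by
  have hj' : j < n + 1 := by omega
  let z : Fin (n + 1) → β := Fin.insertNth ⟨j, hj'⟩ a yc
  have hmono (f : {f : LinExt β // PsiEvent yc a j f}) : StrictMono (f.1.1 ∘ z) :=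
    htc.strictMono_comp_insertNth hj' f.2
  let T (f : {f : LinExt β // PsiEvent yc a j f}) :
      powersetCard (n + 1) (univ : Finset (Fin (Fintype.card β))) :=
    ⟨univ.image (f.1.1 ∘ z), mem_powersetCard.2 ⟨subset_univ _, by
      rw [card_image_of_injective _ (hmono f).injective, card_univ, Fintype.card_fin]⟩⟩
  have hinj : Function.Injective T := by
    intro f g hfg
    have hrange : Set.range (f.1.1 ∘ z) = Set.range (g.1.1 ∘ z) := by
      simpa [T, Function.comp_def] using congrArg (fun s => (s.1 : Set (Fin (Fintype.card β)))) hfg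
    have hz := ((hmono f).range_inj (hmono g)).1 hrange
    refine Subtype.ext (htc.linExt_ext (funext fun k => ?_))
    simpa [z] using congrFun hz (Fin.succAbove ⟨j, hj'⟩ k)
  have := Nat.card_le_card_of_injective T hinj
  simpa [htc.card_eq] using this

lemma pr_psiEvent_le (htc : TwoChains xc yc)
    (hnone : ∀ (i : Fin m) (j : Fin n), ¬ xc i ≤ yc j ∧ ¬ yc j ≤ xc i)
    (a : β) {j : ℕ} (hj : j ≤ n) : Pr (PsiEvent yc a j) ≤ (m : ℝ) / (n + 1) := by
  have htotal := htc.choose_le_card_linExt hnone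
  have hpos : 0 < Nat.card (LinExt β) :=
    (Nat.choose_pos (Nat.le_add_right n m)).trans_le htotal
  rw [Pr, div_le_div_iff₀ (by exact_mod_cast hpos) (by positivity)]
  norm_cast
  calc Nat.card {f : LinExt β // PsiEvent yc a j f} * (n + 1)
      ≤ (n + m).choose (n + 1) * (n + 1) := Nat.mul_le_mul_right _ (htc.card_psiEvent_le a hj)
    _ = m * (n + m).choose n := by
      rw [Nat.choose_succ_right_eq, Nat.add_sub_cancel_left, mul_comm]
    _ ≤ m * Nat.card (LinExt β) := Nat.mul_le_mul_left _ htotal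

end TwoChains

/-- if `P = X + Y` (no relations between the chains `X` and `Y`) and
`m < ε·n - 1`, then `ℙ(Ψ_{i,j}) < ε` for every `i ∈ {1,…,m}` and `j ∈ {0,…,n}`. -/
theorem stmt_18 (β : Type) [Fintype β] [PartialOrder β] (m n : ℕ)
    (xc : Fin m → β) (yc : Fin n → β) (htc : TwoChains xc yc)
    (hnone : ∀ (i : Fin m) (j : Fin n), ¬ xc i ≤ yc j ∧ ¬ yc j ≤ xc i)
    (ε : ℝ) (hε : 0 < ε) (hmn : (m : ℝ) < ε * (n : ℝ) - 1)
    (i j : ℕ) (hi1 : 1 ≤ i) (him : i ≤ m) (hjn : j ≤ n) :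
    Pr (PsiEvent yc (xc ⟨i - 1, by omega⟩) j) < ε := by
  refine (htc.pr_psiEvent_le hnone _ hjn).trans_lt ?_
  rw [div_lt_iff₀ (by positivity)]
  linarith
end

section
/- For every ε > 0 there exists K > 0 such that: for every finite unidirectional poset P on the disjoint union of chains X = {x_1 < ⋯ < x_m} and Y = {y_1 < ⋯ < y_n} (no relations x_i > y_j), and all i ∈ {1,…,m}, j ∈ {1,…,n} satisfying j > K, n − j > K, and i·(n − j) < (1 + 1/K)·j·(m − i), one has ℙ(Ψ_{i,j}) < ε. -/
open Finset

/-- In `Fin n`, a downward closed predicate holds exactly on the first elements. -/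
lemma lt_card_filter_iff {n : ℕ} {p : Fin n → Prop} [DecidablePred p]
    (hp : ∀ i j, i ≤ j → p j → p i) (j : Fin n) : (j : ℕ) < #{i | p i} ↔ p j := by
  constructor
  · contrapose!
    intro hj
    calc #{i | p i} ≤ #(Finset.Iio j) := by
          refine card_le_card fun i hi => ?_
          simp only [mem_filter, mem_univ, true_and] at hi
          exact Finset.mem_Iio.2 (lt_of_not_ge fun h => hj (hp _ _ h hi))
      _ = j := Fin.card_Iio j
  · intro hj
    calc (j : ℕ) < #(Finset.Iic j) := by rw [Fin.card_Iic]; omega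
      _ ≤ #{i | p i} := by
          refine card_le_card fun i hi => ?_
          simpa using hp _ _ (Finset.mem_Iic.1 hi) hj

/-- Monotone sequences of length `a` bounded above by `u` and by `k`. -/
def monoLE (u : ℕ → ℕ) (a k : ℕ) : Set (Fin a → ℕ) :=
  {g | Monotone g ∧ ∀ x : Fin a, g x ≤ u x ∧ g x ≤ k}

/-- Monotone sequences of length `b` bounded above by `u` and below by `k`. -/
def monoGE (u : ℕ → ℕ) (b k : ℕ) : Set (Fin b → ℕ) :=
  {g | Monotone g ∧ ∀ x : Fin b, g x ≤ u x ∧ k ≤ g x}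

lemma finite_monoLE (u : ℕ → ℕ) (a k : ℕ) : (monoLE u a k).Finite :=
  (Set.finite_Iic fun _ => k).subset fun _ hg x => (hg.2 x).2

lemma finite_monoGE (u : ℕ → ℕ) (b k : ℕ) : (monoGE u b k).Finite :=
  (Set.finite_Iic fun x : Fin b => u x).subset fun _ hg x => (hg.2 x).1

lemma snoc_mem_monoLE {u : ℕ → ℕ} {a k l : ℕ} {g : Fin a → ℕ} (hg : g ∈ monoLE u a l)
    (hl : l ≤ u a) (hk : l ≤ k) : (Fin.snoc g l : Fin (a + 1) → ℕ) ∈ monoLE u (a + 1) k := by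
  constructor
  · intro x y hxy
    induction y using Fin.lastCases with
    | last =>
      induction x using Fin.lastCases with
      | last => simp
      | cast x => simpa using (hg.2 x).2
    | cast y =>
      induction x using Fin.lastCases with
      | last => exact absurd hxy (by simp [Fin.le_def])
      | cast x => simpa using hg.1 (by simpa using hxy)
  · intro x
    induction x using Fin.lastCases with
    | last => simpa using ⟨hl, hk⟩
    | cast x => simpa using ⟨(hg.2 x).1, (hg.2 x).2.trans hk⟩

lemma init_mem_monoLE {u : ℕ → ℕ} {a k : ℕ} {g : Fin (a + 1) → ℕ}
    (hg : g ∈ monoLE u (a + 1) k) : Fin.init g ∈ monoLE u a (g (Fin.last a)) :=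
  ⟨fun _ _ hxy => hg.1 (by simpa using hxy),
    fun x => ⟨(hg.2 x.castSucc).1, hg.1 (Fin.le_last _)⟩⟩

lemma monoLE_succ_zero (u : ℕ → ℕ) (a : ℕ) :
    (monoLE u (a + 1) 0).ncard = (monoLE u a 0).ncard := by
  have : monoLE u (a + 1) 0 = (fun g => Fin.snoc g 0) '' monoLE u a 0 := by
    ext g
    constructor
    · intro hg
      have h0 : g (Fin.last a) = 0 := Nat.le_zero.1 (hg.2 _).2
      refine ⟨Fin.init g, by simpa [h0] using init_mem_monoLE hg, ?_⟩
      conv_rhs => rw [← Fin.snoc_init_self g, h0]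
    · rintro ⟨g, hg, rfl⟩
      exact snoc_mem_monoLE hg (Nat.zero_le _) le_rfl
  rw [this, Set.ncard_image_of_injective _ (Fin.snoc_left_injective (α := fun _ => ℕ) 0)]

lemma monoLE_succ_succ {u : ℕ → ℕ} {a k : ℕ} (hk : k + 1 ≤ u a) :
    (monoLE u (a + 1) (k + 1)).ncard = (monoLE u (a + 1) k).ncard + (monoLE u a (k + 1)).ncard := by
  have : monoLE u (a + 1) (k + 1) =
      monoLE u (a + 1) k ∪ (fun g => Fin.snoc g (k + 1)) '' monoLE u a (k + 1) := by
    ext g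
    constructor
    · intro hg
      by_cases h : g (Fin.last a) = k + 1
      · right
        refine ⟨Fin.init g, by simpa [h] using init_mem_monoLE hg, ?_⟩
        conv_rhs => rw [← Fin.snoc_init_self g, h]
      · left
        refine ⟨hg.1, fun x => ⟨(hg.2 x).1, ?_⟩⟩
        have h1 := hg.1 (Fin.le_last x)
        have h2 := (hg.2 (Fin.last a)).2
        omega
    · rintro (hg | ⟨g, hg, rfl⟩)
      · exact ⟨hg.1, fun x => ⟨(hg.2 x).1, (hg.2 x).2.trans (Nat.le_succ k)⟩⟩
      · exact snoc_mem_monoLE hg hk le_rfl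
  rw [this, Set.ncard_union_eq _ (finite_monoLE ..) ((finite_monoLE ..).image _),
    Set.ncard_image_of_injective _ (Fin.snoc_left_injective (α := fun _ => ℕ) (k + 1))]
  rw [Set.disjoint_left]
  rintro _ hg ⟨g, -, rfl⟩
  simpa using (hg.2 (Fin.last a)).2

lemma monoLE_succ_of_lt {u : ℕ → ℕ} {a k : ℕ} (hk : u a ≤ k) :
    monoLE u (a + 1) (k + 1) = monoLE u (a + 1) k := by
  ext g
  refine and_congr_right fun hg => ⟨fun h x => ⟨(h x).1, ?_⟩, fun h x => ⟨(h x).1, ?_⟩⟩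
  · exact (hg (Fin.le_last x)).trans ((h (Fin.last a)).1.trans hk)
  · exact (h x).2.trans (Nat.le_succ k)

/-- The constraint `u` can only increase the ratio of consecutive counts. -/
lemma monoLE_ratio (u : ℕ → ℕ) (a k : ℕ) :
    (k + 1) * (monoLE u a (k + 1)).ncard ≤ (a + k + 1) * (monoLE u a k).ncard := by
  induction a generalizing k with
  | zero =>
    have (k : ℕ) : monoLE u 0 k = Set.univ := Set.eq_univ_of_forall fun g =>
      ⟨fun x => x.elim0, fun x => x.elim0⟩
    simp [this]
  | succ a ih =>
    rcases le_or_gt (u a) k with hk | hk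
    · rw [monoLE_succ_of_lt hk]
      gcongr
      omega
    · have key : (k + 1) * (monoLE u a (k + 1)).ncard ≤ (a + 1) * (monoLE u (a + 1) k).ncard := by
        induction k with
        | zero => simpa [monoLE_succ_zero] using ih 0
        | succ k ihk =>
          rw [monoLE_succ_succ hk.le]
          have h1 := ihk (by omega)
          have h2 := ih (k + 1)
          nlinarith
      rw [monoLE_succ_succ hk]
      nlinarith

lemma cons_mem_monoGE {u : ℕ → ℕ} {b k : ℕ} {g : Fin b → ℕ}
    (hg : g ∈ monoGE (fun x => u (x + 1)) b k) (hk : k ≤ u 0) :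
    (Fin.cons k g : Fin (b + 1) → ℕ) ∈ monoGE u (b + 1) k := by
  constructor
  · intro x y hxy
    induction x using Fin.cases with
    | zero =>
      induction y using Fin.cases with
      | zero => simp
      | succ y => simpa using (hg.2 y).2
    | succ x =>
      induction y using Fin.cases with
      | zero => exact absurd hxy (by simp)
      | succ y => simpa using hg.1 (by simpa using hxy)
  · intro x
    induction x using Fin.cases with
    | zero => simpa using hk
    | succ x => simpa using hg.2 x

lemma monoGE_succ_eq_empty {u : ℕ → ℕ} {b k : ℕ} (hk : u 0 < k) : monoGE u (b + 1) k = ∅ :=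
  Set.eq_empty_of_forall_notMem fun g hg => by
    have := hg.2 0
    simp only [Fin.val_zero] at this
    omega

lemma monoGE_succ {u : ℕ → ℕ} {b k : ℕ} (hk : k ≤ u 0) :
    (monoGE u (b + 1) k).ncard =
      (monoGE u (b + 1) (k + 1)).ncard + (monoGE (fun x => u (x + 1)) b k).ncard := by
  have : monoGE u (b + 1) k = monoGE u (b + 1) (k + 1) ∪
      (fun g => Fin.cons k g) '' monoGE (fun x => u (x + 1)) b k := by
    ext g
    constructor
    · intro hg
      by_cases h : g 0 = k
      · right
        refine ⟨Fin.tail g, ⟨fun x y hxy => hg.1 (by simpa using hxy),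
          fun x => by simpa [Fin.tail] using hg.2 x.succ⟩, ?_⟩
        conv_rhs => rw [← Fin.cons_self_tail g, h]
      · left
        refine ⟨hg.1, fun x => ⟨(hg.2 x).1, ?_⟩⟩
        have h1 := hg.1 (Fin.zero_le x)
        have h2 := (hg.2 0).2
        omega
    · rintro (hg | ⟨g, hg, rfl⟩)
      · exact ⟨hg.1, fun x => ⟨(hg.2 x).1, (Nat.le_succ k).trans (hg.2 x).2⟩⟩
      · exact cons_mem_monoGE hg hk
  rw [this, Set.ncard_union_eq _ (finite_monoGE ..) ((finite_monoGE ..).image _),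
    Set.ncard_image_of_injective _ (Fin.cons_right_injective (α := fun _ => ℕ) k)]
  rw [Set.disjoint_left]
  rintro _ hg ⟨g, -, rfl⟩
  simpa using (hg.2 0).2

/-- The constraint `u` can only decrease the ratio of consecutive counts. -/
lemma monoGE_ratio {n : ℕ} (u : ℕ → ℕ) (hu : ∀ x, u x ≤ n) (b k d : ℕ) (hd : k + d = n) :
    (b + d) * (monoGE u b (k + 1)).ncard ≤ d * (monoGE u b k).ncard := by
  induction b generalizing u k d with
  | zero =>
    have (k : ℕ) : monoGE u 0 k = Set.univ := Set.eq_univ_of_forall fun g =>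
      ⟨fun x => x.elim0, fun x => x.elim0⟩
    simp [this]
  | succ b ih =>
    rcases lt_or_ge (u 0) (k + 1) with hk | hk
    · simp [monoGE_succ_eq_empty hk]
    · have key : (b + 1) * (monoGE u (b + 1) (k + 1)).ncard ≤
          d * (monoGE (fun x => u (x + 1)) b k).ncard := by
        clear hk
        induction d generalizing k with
        | zero =>
          have : u 0 < k + 1 := by have := hu 0; omega
          simp [monoGE_succ_eq_empty this]
        | succ d ihd =>
          rcases lt_or_ge (u 0) (k + 1) with hk | hk
          · simp [monoGE_succ_eq_empty hk]
          · have h1 := ihd (k + 1) (by omega)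
            have h2 := ih (fun x => u (x + 1)) (fun x => hu _) k (d + 1) (by omega)
            rw [monoGE_succ hk]
            nlinarith
      rw [monoGE_succ (k := k) (by omega)]
      nlinarith

/-- Monotone sequences with a prescribed value split at that value. -/
lemma ncard_mono_eq {u : ℕ → ℕ} {m i b k : ℕ} (hm : m = i + 1 + b) (hi : i < m) (hk : k ≤ u i) :
    {g : Fin m → ℕ | Monotone g ∧ (∀ x : Fin m, g x ≤ u x) ∧ g ⟨i, hi⟩ = k}.ncard =
      (monoLE u i k).ncard * (monoGE (fun x => u (x + (i + 1))) b k).ncard := by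
  rw [← Set.ncard_prod]
  refine Set.ncard_congr (fun g _ => (fun x => g ⟨x, by omega⟩, fun x => g ⟨x + (i + 1), by omega⟩))
    ?_ ?_ ?_
  · rintro g ⟨hg, hu, rfl⟩
    exact ⟨⟨fun x y hxy => hg hxy, fun x => ⟨hu _, hg (Fin.mk_le_mk.2 x.2.le)⟩⟩,
      ⟨fun x y hxy => hg (Fin.mk_le_mk.2 (Nat.add_le_add_right hxy _)),
        fun x => ⟨hu _, hg (Fin.mk_le_mk.2 (by omega))⟩⟩⟩
  · rintro g g' ⟨-, -, h⟩ ⟨-, -, h'⟩ he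
    simp only [Prod.mk.injEq, funext_iff] at he
    ext ⟨x, hx⟩
    rcases lt_trichotomy x i with hxi | rfl | hxi
    · exact he.1 ⟨x, hxi⟩
    · rw [h, h']
    · have := he.2 ⟨x - (i + 1), by omega⟩
      simpa only [Nat.sub_add_cancel (show i + 1 ≤ x from hxi)] using this
  · rintro ⟨p, q⟩ ⟨hp, hq⟩
    refine ⟨fun x => if h : (x : ℕ) < i then p ⟨x, h⟩ else
      if h' : (x : ℕ) = i then k else q ⟨x - (i + 1), by omega⟩, ⟨?_, ?_, ?_⟩, ?_⟩
    · intro x y hxy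
      have hxy' : (x : ℕ) ≤ y := hxy
      dsimp only
      split_ifs
      · exact hp.1 hxy
      · exact (hp.2 _).2
      · exact (hp.2 _).2.trans (hq.2 _).2
      · omega
      · exact le_rfl
      · exact (hq.2 _).2
      · omega
      · omega
      · exact hq.1 (Fin.mk_le_mk.2 (by omega))
    · intro x
      dsimp only
      split_ifs with h h'
      · exact (hp.2 _).1
      · rwa [h']
      · have := (hq.2 ⟨x - (i + 1), by omega⟩).1
        simpa only [Nat.sub_add_cancel (show i + 1 ≤ x by omega)] using this
    · simp
    · ext x
      · simp
      · simp [show ¬ (x : ℕ) + (i + 1) < i by omega, show ¬ (x : ℕ) + (i + 1) = i by omega]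

section TwoChains

variable {β : Type} [Fintype β] [PartialOrder β] {m n : ℕ} {xc : Fin m → β} {yc : Fin n → β}

/-- The number of elements of the chain `Y` preceding `x`. -/
def gap (yc : Fin n → β) (f : LinExt β) (x : β) : ℕ := #{j | f.1 (yc j) < f.1 x}

lemma TwoChains.x_lt (h : TwoChains xc yc) {i j : Fin m} : xc i < xc j ↔ i < j := by
  simp only [lt_iff_le_not_ge, h.xchain]

lemma TwoChains.y_lt (h : TwoChains xc yc) {i j : Fin n} : yc i < yc j ↔ i < j := by
  simp only [lt_iff_le_not_ge, h.ychain]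

lemma LinExt.le {f : LinExt β} {x y : β} (h : x ≤ y) : f.1 x ≤ f.1 y := by
  rcases h.eq_or_lt with rfl | h
  · exact le_rfl
  · exact (f.2 _ _ h).le

lemma TwoChains.lt_gap_iff (h : TwoChains xc yc) (f : LinExt β) (x : β) (j : Fin n) :
    (j : ℕ) < gap yc f x ↔ f.1 (yc j) < f.1 x :=
  lt_card_filter_iff (p := fun j => f.1 (yc j) < f.1 x)
    (fun _ _ hij hj => (LinExt.le ((h.ychain _ _).2 hij)).trans_lt hj) j

lemma gap_le (f : LinExt β) (x : β) : gap yc f x ≤ n :=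
  (card_le_univ _).trans_eq (Fintype.card_fin n)

lemma TwoChains.psiEvent_iff (h : TwoChains xc yc) (f : LinExt β) (i : Fin m) {k : ℕ}
    (hk : k ≤ n) : PsiEvent yc (xc i) k f ↔ gap yc f (xc i) = k := by
  have hne (j : Fin n) : f.1 (xc i) ≠ f.1 (yc j) := fun he => h.disj i j (f.1.injective he)
  have hlt (j : Fin n) : val f (yc j) < val f (xc i) ↔ (j : ℕ) < gap yc f (xc i) := by
    rw [h.lt_gap_iff, Fin.lt_def]; simp [_root_.val]
  have hgt (j : Fin n) : val f (xc i) < val f (yc j) ↔ gap yc f (xc i) ≤ j := by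
    rw [← not_lt, h.lt_gap_iff, not_lt, (hne j).le_iff_lt, Fin.lt_def]; simp [_root_.val]
  have hle := gap_le (yc := yc) f (xc i)
  simp only [PsiEvent, hlt, hgt]
  constructor
  · rintro ⟨h1, h2⟩
    apply le_antisymm
    · rcases hk.eq_or_lt with rfl | hk
      · exact hle
      · exact h2 ⟨k, hk⟩ rfl
    · rcases Nat.eq_zero_or_pos k with rfl | hk0
      · exact Nat.zero_le _
      · have := h1 ⟨k - 1, by omega⟩ (by simp; omega)
        simp only at this
        omega
  · rintro rfl
    exact ⟨fun j hj => by omega, fun j hj => hj.ge⟩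

lemma TwoChains.gap_injective (h : TwoChains xc yc) :
    Function.Injective fun (f : LinExt β) (i : Fin m) => gap yc f (xc i) := by
  intro f f' he
  have hyx (i : Fin m) (j : Fin n) : f.1 (yc j) < f.1 (xc i) ↔ f'.1 (yc j) < f'.1 (xc i) := by
    rw [← h.lt_gap_iff, ← h.lt_gap_iff, show gap yc f (xc i) = gap yc f' (xc i) from congrFun he i]
  have hlt (z w : β) (hzw : f.1 z ≤ f.1 w) : f'.1 z ≤ f'.1 w := by
    rcases h.cover z with ⟨i, rfl⟩ | ⟨i, rfl⟩ <;> rcases h.cover w with ⟨j, rfl⟩ | ⟨j, rfl⟩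
    · exact LinExt.le ((h.xchain _ _).2 (le_of_not_gt fun hji =>
        hzw.not_gt (f.2 _ _ (h.x_lt.2 hji))))
    · exact not_lt.1 fun hlt => hzw.not_gt ((hyx _ _).2 hlt)
    · refine ((hyx _ _).1 (hzw.lt_of_ne fun he => h.disj j i (f.1.injective he).symm)).le
    · exact LinExt.le ((h.ychain _ _).2 (le_of_not_gt fun hji =>
        hzw.not_gt (f.2 _ _ (h.y_lt.2 hji))))
  have hmono : StrictMono (f.1.symm.trans f'.1) :=
    Monotone.strictMono_of_injective (fun a b hab => hlt _ _ (by simpa using hab))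
      (Equiv.injective _)
  let e := hmono.orderIsoOfSurjective _ (Equiv.surjective _)
  refine Subtype.ext (Equiv.ext fun z => ?_)
  have : e (f.1 z) = f.1 z := by rw [Subsingleton.elim e (OrderIso.refl _)]; rfl
  rw [← this]
  exact congrArg f'.1 (f.1.symm_apply_apply z)

lemma TwoChains.exists_gap_eq (h : TwoChains xc yc) (hP : Unidir xc yc) {g : Fin m → ℕ}
    (hg : Monotone g) (hgn : ∀ i, g i ≤ n) (hgy : ∀ i j, xc i ≤ yc j → g i ≤ j) :
    ∃ f : LinExt β, ∀ i, gap yc f (xc i) = g i := by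
  have hc (i : Fin m) (j : Fin n) : (i : ℕ) < #{i | g i ≤ j} ↔ g i ≤ j :=
    lt_card_filter_iff (p := fun i => g i ≤ j) (fun _ _ hab hb => (hg hab).trans hb) i
  have hcm (j : Fin n) : #{i | g i ≤ j} ≤ m := (card_le_univ _).trans_eq (Fintype.card_fin m)
  have hc_mono {j j' : Fin n} (hj : j ≤ j') : #{i | g i ≤ j} ≤ #{i | g i ≤ j'} :=
    card_le_card fun i hi => by
      simp only [mem_filter, mem_univ, true_and] at hi ⊢
      exact hi.trans hj
  have hbij : Function.Bijective (Sum.elim xc yc) := by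
    constructor
    · rintro (i | i) (j | j) hij
      · exact congrArg _ (le_antisymm ((h.xchain _ _).1 hij.le) ((h.xchain _ _).1 hij.ge))
      · exact absurd hij (h.disj i j)
      · exact absurd hij.symm (h.disj j i)
      · exact congrArg _ (le_antisymm ((h.ychain _ _).1 hij.le) ((h.ychain _ _).1 hij.ge))
    · intro z
      rcases h.cover z with ⟨i, rfl⟩ | ⟨i, rfl⟩
      exacts [⟨Sum.inl i, rfl⟩, ⟨Sum.inr i, rfl⟩]
  let e := Equiv.ofBijective _ hbij
  have hcard : m + n = Fintype.card β := by simpa using Fintype.card_congr e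
  let pos : Fin m ⊕ Fin n → ℕ := Sum.elim (fun i => i + g i) fun j => j + #{i | g i ≤ j}
  have hxx {i j : Fin m} (hij : i < j) : pos (.inl i) < pos (.inl j) :=
    add_lt_add_of_lt_of_le hij (hg hij.le)
  have hyy {i j : Fin n} (hij : i < j) : pos (.inr i) < pos (.inr j) :=
    add_lt_add_of_lt_of_le hij (hc_mono hij.le)
  have hxy {i : Fin m} {j : Fin n} (hij : g i ≤ j) : pos (.inl i) < pos (.inr j) := by
    have := (hc i j).2 hij
    simp only [pos, Sum.elim_inl, Sum.elim_inr]
    omega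
  have hyx {i : Fin m} {j : Fin n} (hij : j < g i) : pos (.inr j) < pos (.inl i) := by
    have := mt (hc i j).1 hij.not_ge
    simp only [pos, Sum.elim_inl, Sum.elim_inr]
    omega
  have hpos_lt (s : Fin m ⊕ Fin n) : pos s < Fintype.card β := by
    rw [← hcard]
    rcases s with i | j
    · exact add_lt_add_of_lt_of_le i.2 (hgn i)
    · have := hcm j
      simp only [pos, Sum.elim_inr]
      omega
  have hpos_inj : Function.Injective pos := by
    rintro (i | i) (j | j) hij
    · rcases lt_trichotomy i j with hlt | rfl | hlt
      exacts [absurd hij (hxx hlt).ne, rfl, absurd hij (hxx hlt).ne']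
    · rcases le_or_gt (g i) j with hlt | hlt
      exacts [absurd hij (hxy hlt).ne, absurd hij (hyx hlt).ne']
    · rcases le_or_gt (g j) i with hlt | hlt
      exacts [absurd hij (hxy hlt).ne', absurd hij (hyx hlt).ne]
    · rcases lt_trichotomy i j with hlt | rfl | hlt
      exacts [absurd hij (hyy hlt).ne, rfl, absurd hij (hyy hlt).ne']
  let F : β → Fin (Fintype.card β) := fun z => ⟨pos (e.symm z), hpos_lt _⟩
  have hF : Function.Bijective F := by
    rw [Fintype.bijective_iff_injective_and_card]
    refine ⟨fun z w hzw => e.symm.injective (hpos_inj (Fin.mk.inj_iff.1 hzw)), by simp⟩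
  have hex (i : Fin m) : e.symm (xc i) = .inl i := e.symm_apply_eq.2 rfl
  have hey (j : Fin n) : e.symm (yc j) = .inr j := e.symm_apply_eq.2 rfl
  let f : LinExt β := ⟨Equiv.ofBijective F hF, by
    intro z w hzw
    change pos (e.symm z) < pos (e.symm w)
    rcases h.cover z with ⟨i, rfl⟩ | ⟨i, rfl⟩ <;> rcases h.cover w with ⟨j, rfl⟩ | ⟨j, rfl⟩ <;>
      simp only [hex, hey]
    · exact hxx (h.x_lt.1 hzw)
    · exact hxy (hgy _ _ hzw.le)
    · exact absurd hzw.le (hP j i)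
    · exact hyy (h.y_lt.1 hzw)⟩
  refine ⟨f, fun i => ?_⟩
  have hlt (j : Fin n) : (j : ℕ) < gap yc f (xc i) ↔ (j : ℕ) < g i := by
    rw [h.lt_gap_iff]
    change pos (e.symm (yc j)) < pos (e.symm (xc i)) ↔ _
    rw [hex, hey]
    exact ⟨fun hlt => lt_of_not_ge fun hle => hlt.not_gt (hxy hle), hyx⟩
  have hle := gap_le (yc := yc) f (xc i)
  apply le_antisymm <;> by_contra! hcon
  · exact lt_irrefl _ ((hlt ⟨g i, by omega⟩).1 hcon)
  · exact lt_irrefl _ ((hlt ⟨gap yc f (xc i), hcon.trans_le (hgn i)⟩).2 hcon)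

/-- Consecutive counts of linear extensions satisfying `Ψ_{i,k}` have at least the ratio they
have in the absence of relations between the chains. -/
lemma TwoChains.ncard_gap_ratio (h : TwoChains xc yc) (hP : Unidir xc yc) (i : Fin m) {k : ℕ}
    (hk : k < n) :
    (k + 1) * ((m - (i + 1)) + (n - k)) * {f : LinExt β | gap yc f (xc i) = k + 1}.ncard ≤
      (i + k + 1) * (n - k) * {f : LinExt β | gap yc f (xc i) = k}.ncard := by
  classical
  obtain ⟨u, hun, hu⟩ : ∃ u : ℕ → ℕ, (∀ x, u x ≤ n) ∧ ∀ (i : Fin m) (l : ℕ),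
      l ≤ u i ↔ l ≤ n ∧ ∀ j, xc i ≤ yc j → l ≤ j := by
    refine ⟨fun x => Nat.findGreatest
      (fun l => ∀ (hx : x < m) (j : Fin n), xc ⟨x, hx⟩ ≤ yc j → l ≤ j) n,
      fun x => Nat.findGreatest_le n, fun i l => ⟨fun hl => ⟨hl.trans (Nat.findGreatest_le n),
        fun j hj => ?_⟩, fun hl => ?_⟩⟩
    · exact hl.trans (Nat.findGreatest_spec (P := fun l => ∀ (hx : (i : ℕ) < m) (j : Fin n),
        xc ⟨i, hx⟩ ≤ yc j → l ≤ j) (Nat.zero_le n) (fun _ _ _ => Nat.zero_le _) i.2 j hj)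
    · exact Nat.le_findGreatest hl.1 fun _ => hl.2
  have hcount (k : ℕ) : {f : LinExt β | gap yc f (xc i) = k}.ncard =
      {g : Fin m → ℕ | Monotone g ∧ (∀ x : Fin m, g x ≤ u x) ∧ g i = k}.ncard := by
    rw [← Set.ncard_image_of_injective _ h.gap_injective]
    congr 1
    ext g
    constructor
    · rintro ⟨f, hf, rfl⟩
      refine ⟨fun a b hab => card_le_card fun j hj => ?_,
        fun x => (hu _ _).2 ⟨gap_le .., fun j hj => ?_⟩, hf⟩
      · simp only [mem_filter, mem_univ, true_and] at hj ⊢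
        exact hj.trans_le (LinExt.le ((h.xchain _ _).2 hab))
      · exact not_lt.1 fun hlt => ((h.lt_gap_iff _ _ _).1 hlt).not_ge (LinExt.le hj)
    · rintro ⟨hg, hgu, hgi⟩
      obtain ⟨f, hf⟩ := h.exists_gap_eq hP hg (fun x => ((hu _ _).1 (hgu x)).1)
        fun x => ((hu _ _).1 (hgu x)).2
      exact ⟨f, (hf i).trans hgi, funext hf⟩
  rcases le_or_gt (k + 1) (u i) with hki | hki
  · have hm : m = i + 1 + (m - (i + 1)) := by omega
    rw [hcount, hcount, ncard_mono_eq hm i.2 hki, ncard_mono_eq hm i.2 (by omega)]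
    have h1 := monoLE_ratio u i k
    have h2 := monoGE_ratio (fun x => u (x + (i + 1))) (fun x => hun _) (m - (i + 1)) k (n - k)
      (by omega)
    calc _ = ((k + 1) * (monoLE u i (k + 1)).ncard) * ((m - (i + 1) + (n - k)) *
          (monoGE (fun x => u (x + (i + 1))) (m - (i + 1)) (k + 1)).ncard) := by ring
      _ ≤ _ := Nat.mul_le_mul h1 h2
      _ = _ := by ring
  · have : {g : Fin m → ℕ | Monotone g ∧ (∀ x : Fin m, g x ≤ u x) ∧ g i = k + 1} = ∅ :=
      Set.eq_empty_of_forall_notMem fun g hg => by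
        have h1 := hg.2.1 i
        have h2 := hg.2.2
        omega
    rw [hcount (k + 1), this]
    simp

end TwoChains

/-- A sequence losing a factor of at most `1 - δ` per step stays large for a while. -/
lemma one_sub_mul_le {N : ℕ → ℝ} {j L : ℕ} {δ : ℝ} (hδ : δ ≤ 1) (hN : 0 ≤ N j)
    (hstep : ∀ t < L, (1 - δ) * N (j - t) ≤ N (j - (t + 1))) {t : ℕ} (ht : t ≤ L) :
    (1 - t * δ) * N j ≤ N (j - t) := by
  induction t with
  | zero => simp
  | succ t ih =>
    have h1 := mul_le_mul_of_nonneg_left (ih (by omega)) (sub_nonneg.2 hδ)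
    have h2 := hstep t (by omega)
    have h3 : 0 ≤ t * δ ^ 2 * N j := by positivity
    push_cast
    linarith

/-- The numerical estimate bounding the ratio of consecutive counts, with `s = k + 1` and
`q = n - k`. -/
lemma ratio_estimate {a b j r s q L : ℝ} (hL : 1 ≤ L) (ha : 0 ≤ a) (hb : 0 ≤ b)
    (hs : 0 ≤ s) (hq : 0 ≤ q) (hj : 8 * L ^ 2 < j) (hr : 8 * L ^ 2 < r) (hsj : j - L ≤ s)
    (hqr : q ≤ r + L) (hab : a * r < (1 + 1 / (8 * L ^ 2)) * j * b) :
    (1 - 1 / (2 * L)) * ((a + s) * q) ≤ s * (b + q) := by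
  have hL0 : 0 < L := by linarith
  obtain ⟨η, hη⟩ : ∃ η : ℝ, η = 1 / (8 * L) := ⟨_, rfl⟩
  have hη0 : 0 < η := by rw [hη]; positivity
  have hη8 : η ≤ 1 / 8 := by
    rw [hη]; exact one_div_le_one_div_of_le (by norm_num) (by linarith)
  have hLη : L = η * (8 * L ^ 2) := by rw [hη]; field_simp
  have hδ : 1 / (2 * L) = 4 * η := by rw [hη]; field_simp; norm_num
  have hK : 1 / (8 * L ^ 2) ≤ η := by
    rw [hη]; exact one_div_le_one_div_of_le (by positivity) (by nlinarith)
  have hj0 : 0 < j := lt_trans (by positivity) hj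
  have hr0 : 0 < r := lt_trans (by positivity) hr
  have hq' : q ≤ (1 + η) * r := by nlinarith
  have hs' : (1 - η) * j ≤ s := by nlinarith
  have hjb : 0 ≤ j * b := by positivity
  have hab' : a * r ≤ (1 + η) * (j * b) := by nlinarith
  rw [hδ]
  have hη4 : 0 ≤ 1 - 4 * η := by linarith
  have hmain : (1 - 4 * η) * (a * q) ≤ s * b := by
    calc (1 - 4 * η) * (a * q) ≤ (1 - 4 * η) * (a * ((1 + η) * r)) := by gcongr
      _ = (1 - 4 * η) * (1 + η) * (a * r) := by ring
      _ ≤ (1 - 4 * η) * (1 + η) * ((1 + η) * (j * b)) := by gcongr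
      _ = ((1 - 4 * η) * (1 + η) * (1 + η)) * (j * b) := by ring
      _ ≤ (1 - η) * (j * b) := by
          gcongr
          nlinarith [pow_pos hη0 3]
      _ = (1 - η) * j * b := by ring
      _ ≤ s * b := by gcongr
  nlinarith [mul_nonneg hη0.le (mul_nonneg hs hq)]

/-- If the counts decay slowly below `j`, then each of them is a small part of the total. -/
lemma mul_ncard_fiber_le {α : Type*} [Finite α] (φ : α → ℕ) {j L : ℕ} (hL : 1 ≤ L) (hLj : L ≤ j)
    (hstep : ∀ t < L, (1 - 1 / (2 * (L : ℝ))) * ({x | φ x = j - t}.ncard : ℝ) ≤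
      ({x | φ x = j - (t + 1)}.ncard : ℝ)) :
    (L : ℝ) / 2 * ({x | φ x = j}.ncard : ℝ) ≤ Nat.card α := by
  classical
  have := Fintype.ofFinite α
  have hL' : (1 : ℝ) ≤ L := by exact_mod_cast hL
  have hlow : ∀ t < L, 1 / 2 * ({x | φ x = j}.ncard : ℝ) ≤ ({x | φ x = j - t}.ncard : ℝ) := by
    intro t ht
    have ht' : (t : ℝ) ≤ L := by exact_mod_cast ht.le
    refine le_trans ?_ (one_sub_mul_le (N := fun k => ({x | φ x = k}.ncard : ℝ))
      (δ := 1 / (2 * (L : ℝ))) ?_ (Nat.cast_nonneg _) hstep ht.le)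
    · have : (t : ℝ) * (1 / (2 * (L : ℝ))) ≤ 1 / 2 := by
        rw [mul_one_div, div_le_div_iff₀ (by positivity) (by norm_num)]
        linarith
      gcongr
      linarith
    · rw [div_le_one (by positivity)]
      linarith
  have hsum : ∑ t ∈ range L, {x | φ x = j - t}.ncard ≤ Nat.card α := by
    have h1 (t : ℕ) : {x | φ x = j - t}.ncard = #{x | φ x = j - t} := by
      rw [← Set.ncard_coe_finset]; simp
    simp only [h1]
    rw [← card_biUnion, Nat.card_eq_fintype_card]
    · exact card_le_univ _
    · intro s hs t ht hst
      simp only [coe_range, Set.mem_Iio] at hs ht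
      refine disjoint_filter.2 fun x _ h2 h3 => hst ?_
      omega
  calc (L : ℝ) / 2 * ({x | φ x = j}.ncard : ℝ)
      = ∑ t ∈ range L, 1 / 2 * ({x | φ x = j}.ncard : ℝ) := by
        rw [sum_const, card_range, nsmul_eq_mul]; ring
    _ ≤ ∑ t ∈ range L, ({x | φ x = j - t}.ncard : ℝ) :=
        sum_le_sum fun t ht => hlow t (mem_range.1 ht)
    _ ≤ Nat.card α := by exact_mod_cast hsum

/-- for every `ε > 0` there is `K > 0` such that for every finite
unidirectional poset on two chains and all `i ∈ {1,…,m}`, `j ∈ {1,…,n}` with `j > K`,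
`n - j > K` and `i(n-j) < (1 + 1/K)·j(m-i)`, one has `ℙ(Ψ_{i,j}) < ε`. -/
theorem stmt_19 (ε : ℝ) (hε : 0 < ε) :
    ∃ K : ℝ, 0 < K ∧
      ∀ (β : Type) [Fintype β] [PartialOrder β] (m n : ℕ)
        (xc : Fin m → β) (yc : Fin n → β),
        TwoChains xc yc → Unidir xc yc →
        ∀ i j : ℕ, ∀ (hi1 : 1 ≤ i) (him : i ≤ m) (hj1 : 1 ≤ j) (hjn : j ≤ n),
          K < (j : ℝ) → K < (n : ℝ) - (j : ℝ) →
          (i : ℝ) * ((n : ℝ) - (j : ℝ)) < (1 + 1 / K) * (j : ℝ) * ((m : ℝ) - (i : ℝ)) →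
          Pr (PsiEvent yc (xc ⟨i - 1, by omega⟩) j) < ε := by
  obtain ⟨L, hL⟩ := exists_nat_gt (2 / ε + 1)
  have h2ε : 0 < 2 / ε := by positivity
  have hL1 : (1 : ℝ) ≤ L := by linarith
  have hL1' : 1 ≤ L := by exact_mod_cast hL1
  refine ⟨8 * (L : ℝ) ^ 2, by positivity, ?_⟩
  intro β _ _ m n xc yc h hP i j hi1 him hj1 hjn hj hr hij
  set x : Fin m := ⟨i - 1, by omega⟩
  have hPr : Pr (PsiEvent yc (xc x) j) =
      ({f : LinExt β | gap yc f (xc x) = j}.ncard : ℝ) / Nat.card (LinExt β) := by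
    simp only [Pr, h.psiEvent_iff _ _ hjn]
    rfl
  have hLj : L ≤ j := by
    have : (L : ℝ) ≤ j := by nlinarith
    exact_mod_cast this
  have hmul := mul_ncard_fiber_le (fun f : LinExt β => gap yc f (xc x)) hL1' hLj fun t ht => by
    obtain ⟨k, hk⟩ : ∃ k, j = k + 1 + t := ⟨j - t - 1, by omega⟩
    obtain ⟨r, rfl⟩ : ∃ r, n = j + r := ⟨n - j, by omega⟩
    obtain ⟨b, rfl⟩ : ∃ b, m = i + b := ⟨m - i, by omega⟩
    have hratio := h.ncard_gap_ratio hP x (k := k) (by omega)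
    rw [show j - t = k + 1 by omega, show j - (t + 1) = k by omega]
    rw [show (x : ℕ) = i - 1 from rfl, show i + b - (i - 1 + 1) = b by omega,
      show j + r - k = r + t + 1 by omega] at hratio
    have hratio' : ((k : ℝ) + 1) * (b + (r + t + 1)) *
        ({f : LinExt β | gap yc f (xc x) = k + 1}.ncard : ℝ) ≤ (i + (k + 1)) * (r + t + 1) *
          ({f : LinExt β | gap yc f (xc x) = k}.ncard : ℝ) := by
      have hle : (i - 1 + k + 1) * (r + t + 1) ≤ (i + (k + 1)) * (r + t + 1) :=
        Nat.mul_le_mul_right _ (by omega)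
      exact_mod_cast hratio.trans (Nat.mul_le_mul_right _ hle)
    have hjk : (j : ℝ) = k + 1 + t := by exact_mod_cast hk
    have htL : (t : ℝ) + 1 ≤ L := by exact_mod_cast ht
    push_cast at hr hij
    have hest := ratio_estimate (a := i) (b := b) (j := j) (r := r) (s := k + 1) (q := r + t + 1)
      hL1 (by positivity) (by positivity) (by positivity) (by positivity) hj (by linarith)
      (by linarith) (by linarith) (by simpa using hij)
    have hpos : (0 : ℝ) < (i + (k + 1)) * (r + t + 1) := by positivity
    refine le_of_mul_le_mul_left ?_ hpos
    refine le_trans ?_ hratio'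
    have := mul_le_mul_of_nonneg_right hest
      (Nat.cast_nonneg (α := ℝ) {f : LinExt β | gap yc f (xc x) = k + 1}.ncard)
    linarith
  rw [hPr]
  rcases Nat.eq_zero_or_pos (Nat.card (LinExt β)) with h0 | h0
  · rwa [h0, Nat.cast_zero, div_zero]
  · have h0' : (0 : ℝ) < Nat.card (LinExt β) := by exact_mod_cast h0
    rw [div_lt_iff₀ h0']
    have hεL : 2 < ε * L := by
      have := (div_lt_iff₀ hε).1 (show 2 / ε < L by linarith)
      linarith
    by_contra! hcon
    have := mul_le_mul_of_nonneg_left hcon (show (0 : ℝ) ≤ L / 2 by positivity)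
    nlinarith
end
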